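/- arXiv:math/9805090 — 2 statements merged into one kernel-verified Lean document; each statement's English description precedes it below -/
import Mathlib

section
/- Let Γ = {1,...,9} with degrees defined for i > 0 by |(-i)_1| = 3i-2, |(-i)_2| = |(-i)_3| = 3i-1, |(-i)_4| = |(-i)_5| = |(-i)_6| = 3i, |(-i)_7| = |(-i)_8| = 3i+1, |(-i)_9| = 3i+2. Let E be the 9×9 energy matrix with rows (2,2,2,1,2,2,2,2,2), (1,2,1,1,2,1,2,2,2), (1,1,2,1,1,2,2,2,2), (1,1,1,0,1,1,1,1,1), (0,0,1,1,0,1,1,2,2), (0,1,0,1,1,0,2,1,2), (0,1,0,1,1,0,2,1,2), (0,0,1,1,0,1,1,2,2), (0,0,0,1,0,0,1,1,2). Call a finitely supported multiset π of colored parts (i, α) with i ∈ ℤ_{<0}, α ∈ Γ admissible if it contains no pair i_α, i_β with E α β · E β α ≥ 1 and no pair (i-1)_α, i_β with E α β = 2. Then for every n ≥ 0, the number of admissible colored partitions of total degree n equals p(n), the number of ordinary partitions of n. -/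
def E9 : Fin 9 → Fin 9 → ℕ :=
  ![![2,2,2,1,2,2,2,2,2],
    ![1,2,1,1,2,1,2,2,2],
    ![1,1,2,1,1,2,2,2,2],
    ![1,1,1,0,1,1,1,1,1],
    ![0,0,1,1,0,1,1,2,2],
    ![0,1,0,1,1,0,2,1,2],
    ![0,1,0,1,1,0,2,1,2],
    ![0,0,1,1,0,1,1,2,2],
    ![0,0,0,1,0,0,1,1,2]]

/-- A colored part `(j, α)` represents `(-j)_α`; its degree is given by the
principal specialization (2.1): `|(-j)_1| = 3j-2`, `|(-j)_2| = |(-j)_3| = 3j-1`,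
`|(-j)_4| = |(-j)_5| = |(-j)_6| = 3j`, `|(-j)_7| = |(-j)_8| = 3j+1`, `|(-j)_9| = 3j+2`
(colors `1,…,9` are indices `0,…,8`). -/
def deg9 (x : ℕ+ × Fin 9) : ℕ :=
  ![3 * (x.1 : ℕ) - 2, 3 * (x.1 : ℕ) - 1, 3 * (x.1 : ℕ) - 1,
    3 * (x.1 : ℕ), 3 * (x.1 : ℕ), 3 * (x.1 : ℕ),
    3 * (x.1 : ℕ) + 1, 3 * (x.1 : ℕ) + 1, 3 * (x.1 : ℕ) + 2] x.2

/-- A colored partition (a multiset of parts `(j, α)`, `j ∈ ℕ₊` standing for the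
negative integer `-j`) satisfies the difference `𝒟` condition: it contains no pair
`i_α i_β` with `E α β ⬝ E β α ≥ 1`, and no pair `(i-1)_α i_β` with `E α β = 2`. -/
def Admissible {Γ : Type*} (E : Γ → Γ → ℕ) (π : Multiset (ℕ+ × Γ)) : Prop :=
  (∀ (j : ℕ+) (α β : Γ), ({(j, α), (j, β)} : Multiset (ℕ+ × Γ)) ≤ π → E α β * E β α = 0) ∧
  (∀ (j : ℕ+) (α β : Γ), ({(j + 1, α), (j, β)} : Multiset (ℕ+ × Γ)) ≤ π → E α β ≠ 2)

open PowerSeries in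
/-- `q ^ (s (s - 1)) / (q; q)_s ^ 2` as a power series in `q`. -/
noncomputable def durfeeTerm (s : ℕ) : ℚ⟦X⟧ :=
  X ^ (s * (s - 1)) * ((∏ i ∈ Finset.range s, (1 - X ^ (i + 1)))⁻¹) ^ 2

open PowerSeries in
/-- The quotient `(q ^ k; q ^ k)_N / (q ^ k; q ^ k)_(N - s)`, which vanishes for `s > N`. -/
noncomputable def qFalling (k N s : ℕ) : ℚ⟦X⟧ :=
  ∏ i ∈ Finset.range s, (1 - X ^ (k * (N - i)))

section Series

open PowerSeries Finset

lemma constantCoeff_one_sub_X_pow (m : ℕ) :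
    constantCoeff (1 - (X : ℚ⟦X⟧) ^ (m + 1)) ≠ 0 := by simp

@[simp] lemma durfeeTerm_zero : durfeeTerm 0 = 1 := by simp [durfeeTerm]

lemma durfeeTerm_succ (s : ℕ) :
    (1 - X ^ (s + 1)) ^ 2 * durfeeTerm (s + 1) = X ^ (2 * s) * durfeeTerm s := by
  have h := PowerSeries.mul_inv_cancel _ (constantCoeff_one_sub_X_pow s)
  have e : (s + 1) * (s + 1 - 1) = 2 * s + s * (s - 1) := by
    cases s with
    | zero => rfl
    | succ t => simp only [Nat.add_sub_cancel]; ring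
  simp only [durfeeTerm, prod_range_succ, PowerSeries.mul_inv_rev, e, pow_add]
  set a : ℚ⟦X⟧ := 1 - X ^ s * X ^ 1 with ha
  have h' : a * a⁻¹ = 1 := by rw [ha, ← pow_add]; exact h
  linear_combination (X ^ (2 * s) * X ^ (s * (s - 1)) *
    ((∏ i ∈ range s, (1 - (X : ℚ⟦X⟧) ^ i * X ^ 1))⁻¹) ^ 2 * (a * a⁻¹ + 1)) * h'

@[simp] lemma qFalling_zero (k N : ℕ) : qFalling k N 0 = 1 := by simp [qFalling]

lemma qFalling_succ (k N s : ℕ) :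
    qFalling k N (s + 1) = qFalling k N s * (1 - X ^ (k * (N - s))) := by
  simp [qFalling, prod_range_succ]

lemma qFalling_succ_succ (k N s : ℕ) :
    qFalling k (N + 1) (s + 1) = (1 - X ^ (k * (N + 1))) * qFalling k N s := by
  simp [qFalling, prod_range_succ', mul_comm]

lemma qFalling_eq_zero {k N s : ℕ} (h : N < s) : qFalling k N s = 0 :=
  prod_eq_zero (mem_range.2 h) (by simp)

lemma qFalling_mul (k N s : ℕ) :
    X ^ (k * (s + 1)) * qFalling k N (s + 1) =
      (X ^ (k * (s + 1)) - X ^ (k * (N + 1))) * qFalling k N s := by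
  rcases le_or_gt s N with h | h
  · obtain ⟨d, rfl⟩ := Nat.exists_eq_add_of_le h
    rw [qFalling_succ, Nat.add_sub_cancel_left]
    ring
  · rw [qFalling_eq_zero h, qFalling_eq_zero (h.trans (Nat.lt_succ_self _))]
    ring

lemma X_pow_dvd_qFalling_sub_one {k N s : ℕ} (hk : 0 < k) (hs : s ≤ N + 1) :
    (X : ℚ⟦X⟧) ^ (N + 1 - s) ∣ qFalling k N s - 1 := by
  induction s with
  | zero => simp
  | succ s ih =>
    have h1 : (X : ℚ⟦X⟧) ^ (N + 1 - (s + 1)) ∣ qFalling k N s - 1 :=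
      (pow_dvd_pow _ (by omega)).trans (ih (by omega))
    have h2 : (X : ℚ⟦X⟧) ^ (N + 1 - (s + 1)) ∣ X ^ (k * (N - s)) :=
      pow_dvd_pow _ (by have := Nat.le_mul_of_pos_left (N - s) hk; omega)
    rw [qFalling_succ]
    have : qFalling k N s * (1 - X ^ (k * (N - s))) - 1
        = (qFalling k N s - 1) - qFalling k N s * X ^ (k * (N - s)) := by ring
    rw [this]
    exact dvd_sub h1 (h2.mul_left _)

/-- `∑ s, q ^ (s ^ 2) (q ^ k; q ^ k)_N / ((q ^ k; q ^ k)_(N - s) (q; q)_s ^ 2)`. -/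
noncomputable def durfeeSum (k N : ℕ) : ℚ⟦X⟧ :=
  ∑ s ∈ range (N + 1), X ^ s * durfeeTerm s * qFalling k N s

/-- `∑ s, q ^ (s ^ 2 - s) (q ^ k; q ^ k)_N / ((q ^ k; q ^ k)_(N - s) (q; q)_s ^ 2)`. -/
noncomputable def durfeeSum' (k N : ℕ) : ℚ⟦X⟧ :=
  ∑ s ∈ range (N + 1), durfeeTerm s * qFalling k N s

lemma sum_range_of_telescope {N : ℕ} {f g : ℕ → ℚ⟦X⟧} (h0 : f 0 = g 0)
    (h : ∀ s, X ^ (3 * (s + 1)) * (g s + f (s + 1)) = X ^ (3 * (s + 1)) * g (s + 1))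
    (hN : g (N + 1) = 0) : ∑ s ∈ range (N + 2), f s = 0 := by
  have key : ∀ M, ∑ s ∈ range (M + 1), f s = g M := by
    intro M
    induction M with
    | zero => simp [h0]
    | succ M ih =>
      rw [sum_range_succ, ih]
      exact mul_left_cancel₀ (pow_ne_zero _ X_ne_zero) (h M)
  rw [key, hN]

lemma durfeeSum_extend (k N : ℕ) :
    durfeeSum k N = ∑ s ∈ range (N + 2), X ^ s * durfeeTerm s * qFalling k N s := by
  rw [sum_range_succ _ (N + 1), qFalling_eq_zero (Nat.lt_succ_self N), mul_zero, add_zero,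
    durfeeSum]

lemma durfeeSum'_extend (k N : ℕ) :
    durfeeSum' k N = ∑ s ∈ range (N + 2), durfeeTerm s * qFalling k N s := by
  rw [sum_range_succ _ (N + 1), qFalling_eq_zero (Nat.lt_succ_self N), mul_zero, add_zero,
    durfeeSum']

lemma durfeeSum_one_succ (N : ℕ) :
    (1 - X ^ (N + 1)) * durfeeSum 1 (N + 1) = durfeeSum 1 N := by
  rw [← sub_eq_zero, durfeeSum, durfeeSum_extend, mul_sum, ← sum_sub_distrib]
  refine sum_range_of_telescope
    (g := fun s => - X ^ (N + 1) * X ^ (2 * s) * durfeeTerm s * qFalling 1 N s) ?_ ?_ ?_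
  · simp
  · intro s
    have h1 := durfeeTerm_succ s
    have h2 := qFalling_mul 1 N s
    have h3 := qFalling_succ_succ 1 N s
    simp only [one_mul] at h2 h3
    rw [h3]
    set t := durfeeTerm s
    set t' := durfeeTerm (s + 1)
    set g := qFalling 1 N s
    set g' := qFalling 1 N (s + 1)
    linear_combination (X ^ 3 * X ^ s * (X ^ (N + 1) * X ^ (2 * s)) * g) * h1
      - (X ^ (2 * (s + 1)) * (X ^ (s + 1) - X ^ (N + 1) * X ^ (2 * (s + 1))) * t') * h2
  · simp [qFalling_eq_zero (Nat.lt_succ_self N)]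

lemma durfeeSum_three_succ (N : ℕ) :
    (1 - X ^ (3 * N + 3)) * durfeeSum 3 (N + 1) =
      (1 + 2 * X ^ (3 * N + 3) + 2 * X ^ (3 * N + 2) + X ^ (6 * N + 5)) * durfeeSum 3 N
      + (X ^ (3 * N + 1) + 2 * X ^ (6 * N + 4)) * durfeeSum' 3 N := by
  rw [← sub_eq_zero, durfeeSum, durfeeSum_extend, durfeeSum'_extend, mul_sum, mul_sum, mul_sum,
    ← sum_add_distrib, ← sum_sub_distrib]
  refine sum_range_of_telescope
    (g := fun s => - ((X ^ (3 * N + 1) + 2 * X ^ (6 * N + 4))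
      + (2 * X ^ (3 * N + 2) + X ^ (6 * N + 5)) * X ^ s
      + 3 * X ^ (3 * N + 3) * X ^ (2 * s)) * durfeeTerm s * qFalling 3 N s) ?_ ?_ ?_
  · simp
    ring
  · intro s
    have h1 := durfeeTerm_succ s
    have h2 := qFalling_mul 3 N s
    have h3 := qFalling_succ_succ 3 N s
    rw [h3]
    set t := durfeeTerm s
    set t' := durfeeTerm (s + 1)
    set g := qFalling 3 N s
    set g' := qFalling 3 N (s + 1)
    linear_combination (X ^ 3 * X ^ s * ((X ^ (3 * N + 1) + 2 * X ^ (6 * N + 4))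
        + (2 * X ^ (3 * N + 2) + X ^ (6 * N + 5)) * X ^ s
        + 3 * X ^ (3 * N + 3) * X ^ (2 * s)) * g) * h1
      - ((1 + 2 * X ^ (3 * N + 3) + 2 * X ^ (3 * N + 2) + X ^ (6 * N + 5)) * X ^ (s + 1)
        + (X ^ (3 * N + 1) + 2 * X ^ (6 * N + 4))
        - ((X ^ (3 * N + 1) + 2 * X ^ (6 * N + 4))
        + (2 * X ^ (3 * N + 2) + X ^ (6 * N + 5)) * X ^ (s + 1)
        + 3 * X ^ (3 * N + 3) * X ^ (2 * (s + 1)))) * t' * h2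
  · simp [qFalling_eq_zero (Nat.lt_succ_self N)]

lemma durfeeSum'_three_succ (N : ℕ) :
    (1 - X ^ (3 * N + 3)) * durfeeSum' 3 (N + 1) =
      (2 + X ^ (3 * N + 3) + 3 * X ^ (3 * N + 2)) * durfeeSum 3 N
      + (2 * X ^ (3 * N + 1) + X ^ (6 * N + 4)) * durfeeSum' 3 N := by
  rw [← sub_eq_zero, durfeeSum', durfeeSum_extend, durfeeSum'_extend, mul_sum, mul_sum, mul_sum,
    ← sum_add_distrib, ← sum_sub_distrib]
  refine sum_range_of_telescope
    (g := fun s => - ((2 * X ^ (3 * N + 1) + X ^ (6 * N + 4))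
      + 3 * X ^ (3 * N + 2) * X ^ s
      + (1 + 2 * X ^ (3 * N + 3)) * X ^ (2 * s)) * durfeeTerm s * qFalling 3 N s) ?_ ?_ ?_
  · simp
    ring
  · intro s
    have h1 := durfeeTerm_succ s
    have h2 := qFalling_mul 3 N s
    have h3 := qFalling_succ_succ 3 N s
    rw [h3]
    set t := durfeeTerm s
    set t' := durfeeTerm (s + 1)
    set g := qFalling 3 N s
    set g' := qFalling 3 N (s + 1)
    linear_combination (X ^ 3 * X ^ s * ((2 * X ^ (3 * N + 1) + X ^ (6 * N + 4))
        + 3 * X ^ (3 * N + 2) * X ^ s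
        + (1 + 2 * X ^ (3 * N + 3)) * X ^ (2 * s)) * g) * h1
      - ((2 + X ^ (3 * N + 3) + 3 * X ^ (3 * N + 2)) * X ^ (s + 1)
        + (2 * X ^ (3 * N + 1) + X ^ (6 * N + 4))
        - ((2 * X ^ (3 * N + 1) + X ^ (6 * N + 4))
        + 3 * X ^ (3 * N + 2) * X ^ (s + 1)
        + (1 + 2 * X ^ (3 * N + 3)) * X ^ (2 * (s + 1)))) * t' * h2
  · simp [qFalling_eq_zero (Nat.lt_succ_self N)]

lemma durfeeSum_one_mul_prod (N : ℕ) :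
    durfeeSum 1 N * ∏ i ∈ range N, (1 - X ^ (i + 1)) = 1 := by
  induction N with
  | zero => simp [durfeeSum]
  | succ N ih =>
    rw [prod_range_succ, mul_comm _ (1 - _), ← mul_assoc, mul_comm _ (1 - _), durfeeSum_one_succ,
      ih]

lemma coeff_durfeeSum_eq {k : ℕ} (hk : 0 < k) (n : ℕ) :
    coeff n (durfeeSum k n) = coeff n (durfeeSum 1 n) := by
  have key : ∀ k, 0 < k →
      X ^ (n + 1) ∣ durfeeSum k n - ∑ s ∈ range (n + 1), X ^ s * durfeeTerm s := by
    intro k hk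
    rw [durfeeSum, ← sum_sub_distrib]
    refine dvd_sum fun s hs => ?_
    have hs' : s ≤ n := Nat.lt_succ_iff.1 (mem_range.1 hs)
    have e : s * s = s + s * (s - 1) := by
      cases s with
      | zero => rfl
      | succ t => simp only [Nat.add_sub_cancel]; ring
    have h1 : (X : ℚ⟦X⟧) ^ (s * s) ∣ X ^ s * durfeeTerm s :=
      ⟨_, by rw [durfeeTerm, e, pow_add, ← mul_assoc]⟩
    have h2 := mul_dvd_mul h1 (X_pow_dvd_qFalling_sub_one hk (hs'.trans n.le_succ))
    rw [← pow_add, mul_sub, mul_one] at h2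
    refine (pow_dvd_pow _ ?_).trans h2
    have : s ≤ s * s := Nat.le_mul_self s
    omega
  have h := dvd_sub (key k hk) (key 1 one_pos)
  rw [sub_sub_sub_cancel_right] at h
  have := X_pow_dvd_iff.1 h n (Nat.lt_succ_self n)
  rwa [map_sub, sub_eq_zero] at this

lemma mk_card_restricted_mul_prod (N : ℕ) :
    (PowerSeries.mk fun n => (#(Nat.Partition.restricted n (· ≤ N)) : ℚ))
      * ∏ i ∈ range N, (1 - X ^ (i + 1)) = 1 := by
  let _ : TopologicalSpace ℚ := ⊥
  have : DiscreteTopology ℚ := ⟨rfl⟩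
  let _ := PowerSeries.WithPiTopology.instTopologicalSpace (R := ℚ)
  have := WithPiTopology.instT2Space (R := ℚ)
  have h := Nat.Partition.hasProd_powerSeriesMk_card_restricted ℚ (· ≤ N)
  have h' : HasProd (fun i => if i + 1 ≤ N then ∑' j : ℕ, (X : ℚ⟦X⟧) ^ ((i + 1) * j) else 1)
      (∏ i ∈ range N, if i + 1 ≤ N then ∑' j : ℕ, (X : ℚ⟦X⟧) ^ ((i + 1) * j) else 1) :=
    hasProd_prod_of_ne_finset_one (by intro i hi; rw [if_neg]; simpa using hi)
  rw [h.unique h', ← prod_mul_distrib]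
  refine prod_eq_one fun i hi => ?_
  rw [if_pos (by simpa using hi)]
  simp_rw [pow_mul]
  exact WithPiTopology.tsum_pow_mul_one_sub_of_constantCoeff_eq_zero (by simp)

lemma coeff_durfeeSum {k : ℕ} (hk : 0 < k) (n : ℕ) :
    coeff n (durfeeSum k n) = Fintype.card (Nat.Partition n) := by
  have h0 : ∏ i ∈ range n, (1 - (X : ℚ⟦X⟧) ^ (i + 1)) ≠ 0 :=
    right_ne_zero_of_mul_eq_one (durfeeSum_one_mul_prod n)
  have h := mul_right_cancel₀ h0
    ((durfeeSum_one_mul_prod n).trans (mk_card_restricted_mul_prod n).symm)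
  rw [coeff_durfeeSum_eq hk, h, coeff_mk, Nat.Partition.restricted, filter_true_of_mem,
    Finset.card_univ]
  intro p _ i hi
  exact (Multiset.le_sum_of_mem hi).trans p.parts_sum.le

/-- The degree of a part `(m, c)`, where the level `m` may be zero. -/
def levelDeg (x : ℕ × Fin 9) : ℕ :=
  ![3 * x.1 - 2, 3 * x.1 - 1, 3 * x.1 - 1, 3 * x.1, 3 * x.1, 3 * x.1,
    3 * x.1 + 1, 3 * x.1 + 1, 3 * x.1 + 2] x.2

/-- The closed form of the generating function of color sequences followed by a part of
color `b` at level zero. -/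
noncomputable def crystalSeries (N : ℕ) : Fin 9 → ℚ⟦X⟧ :=
  ![durfeeSum' 3 N, durfeeSum 3 N, durfeeSum 3 N, durfeeSum 3 N, durfeeSum 3 N, durfeeSum 3 N,
    X ^ (3 * N) * durfeeSum' 3 N, X ^ (3 * N) * durfeeSum' 3 N, X ^ (3 * N) * durfeeSum 3 N]

lemma crystalSeries_succ (N : ℕ) (b : Fin 9) :
    (1 - X ^ (3 * N + 3)) * crystalSeries (N + 1) b =
      ∑ c, X ^ levelDeg ((N + 1) * E9 c b, c) * crystalSeries N c := by
  have hA := durfeeSum_three_succ N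
  have hB := durfeeSum'_three_succ N
  have e1 : 3 * (N + 1) - 1 = 3 * N + 2 := by omega
  have e2 : 3 * (N + 1) - 2 = 3 * N + 1 := by omega
  have e3 : 3 * ((N + 1) * 2) - 1 = 6 * N + 5 := by omega
  have e4 : 3 * ((N + 1) * 2) - 2 = 6 * N + 4 := by omega
  fin_cases b <;>
    simp [crystalSeries, E9, levelDeg, Fin.sum_univ_succ, e1, e2, e3, e4]
  · linear_combination hB
  · linear_combination hA
  · linear_combination hA
  · linear_combination hA
  · linear_combination hA
  · linear_combination hA
  · linear_combination X ^ (3 * N + 3) * hB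
  · linear_combination X ^ (3 * N + 3) * hB
  · linear_combination X ^ (3 * N + 3) * hA

end Series

/-- The part `y` may follow the part `x` when parts are listed in increasing order. -/
def Follows (x y : ℕ × Fin 9) : Prop := x.1 + E9 y.2 x.2 ≤ y.1

/-- Sequences of `N` parts of total degree `n` that may follow a part of color `b` at level
zero. -/
def partSeqs (N : ℕ) (b : Fin 9) (n : ℕ) : Set (List (ℕ × Fin 9)) :=
  {l | l.length = N ∧ ((0, b) :: l).Pairwise Follows ∧ (l.map levelDeg).sum = n}

/-- Raise the level of a part by `m`. -/
def raise (m : ℕ) (x : ℕ × Fin 9) : ℕ × Fin 9 := (x.1 + m, x.2)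

lemma raise_injective (m : ℕ) : Function.Injective (raise m) := by
  rintro ⟨i, a⟩ ⟨j, b⟩ h
  simpa [raise] using h

lemma follows_raise_iff {m : ℕ} {x y : ℕ × Fin 9} :
    Follows (raise m x) (raise m y) ↔ Follows x y := by
  simp only [Follows, raise]
  omega

lemma E9_triangle (a b c : Fin 9) : E9 a c ≤ E9 a b + E9 b c := by
  revert a b c; decide

lemma Follows.trans {x y z : ℕ × Fin 9} (h : Follows x y) (h' : Follows y z) : Follows x z := by
  have := E9_triangle z.2 y.2 x.2
  simp only [Follows] at *
  omega

lemma Follows.antisymm {x y : ℕ × Fin 9} (h : Follows x y) (h' : Follows y x) : x = y := by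
  have key : ∀ a b, E9 a b = 0 → E9 b a = 0 → a = b := by decide
  simp only [Follows] at *
  exact Prod.ext (by omega) (key _ _ (by omega) (by omega))

lemma le_levelDeg (x : ℕ × Fin 9) : x.1 ≤ levelDeg x := by
  obtain ⟨m, c⟩ := x
  fin_cases c <;> simp [levelDeg] <;> omega

lemma levelDeg_raise {x : ℕ × Fin 9} {b : Fin 9} (h : Follows (0, b) x) (m : ℕ) :
    levelDeg (raise m x) = levelDeg x + 3 * m := by
  obtain ⟨k, c⟩ := x
  have key : ∀ c b : Fin 9, c < 3 → 1 ≤ E9 c b := by decide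
  have h' := key c b
  simp only [Follows, zero_add] at h
  fin_cases c <;> simp [levelDeg, raise] at * <;> omega

lemma sum_levelDeg_raise {l : List (ℕ × Fin 9)} {b : Fin 9}
    (h : ∀ x ∈ l, Follows (0, b) x) (m : ℕ) :
    ((l.map (raise m)).map levelDeg).sum = (l.map levelDeg).sum + l.length * (3 * m) := by
  induction l with
  | nil => simp
  | cons x l ih =>
    simp only [List.forall_mem_cons] at h
    simp only [List.map_cons, List.sum_cons, ih h.2, levelDeg_raise h.1, List.length_cons]
    ring

lemma exists_map_raise {m : ℕ} {l : List (ℕ × Fin 9)} (h : ∀ x ∈ l, m ≤ x.1) :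
    ∃ l' : List (ℕ × Fin 9), l'.map (raise m) = l := by
  refine ⟨l.map fun x => (x.1 - m, x.2), ?_⟩
  rw [List.map_map]
  refine (List.map_congr_left fun x hx => ?_).trans (List.map_id l)
  simp [raise, Nat.sub_add_cancel (h x hx)]

lemma finite_partSeqs (N : ℕ) (b : Fin 9) (n : ℕ) : (partSeqs N b n).Finite := by
  refine ((List.finite_length_eq (Fin (n + 1) × Fin 9) N).image
    (List.map fun x => ((x.1 : ℕ), x.2))).subset ?_
  rintro l ⟨hl, -, hn⟩
  refine ⟨l.map fun x => (Fin.ofNat (n + 1) x.1, x.2), by simpa using hl, ?_⟩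
  rw [List.map_map]
  refine (List.map_congr_left fun x hx => ?_).trans (List.map_id l)
  have : x.1 ≤ n := (le_levelDeg x).trans
    (hn ▸ List.single_le_sum (by simp) _ (List.mem_map_of_mem hx))
  simp [Fin.ofNat, Nat.mod_eq_of_lt (Nat.lt_succ_of_le this)]

/-- Prepend a part of color `c` at the least admissible level after `(0, b)`. -/
def prependPart (b c : Fin 9) (l : List (ℕ × Fin 9)) : List (ℕ × Fin 9) :=
  (E9 c b, c) :: l.map (raise (E9 c b))

lemma pairwise_prependPart_iff {b c : Fin 9} {l : List (ℕ × Fin 9)} :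
    ((0, b) :: prependPart b c l).Pairwise Follows ↔ ((0, c) :: l).Pairwise Follows := by
  have e : prependPart b c l = ((0, c) :: l).map (raise (E9 c b)) := by
    simp [prependPart, raise]
  rw [List.pairwise_cons, e, List.pairwise_map]
  simp only [follows_raise_iff]
  refine ⟨fun h => h.2, fun h => ⟨?_, h⟩⟩
  rw [← e, prependPart, List.forall_mem_cons]
  have h0 : Follows (0, b) (E9 c b, c) := by simp [Follows]
  refine ⟨h0, fun y hy => ?_⟩
  obtain ⟨x, hx, rfl⟩ := List.mem_map.1 hy
  refine h0.trans ?_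
  have := (List.pairwise_cons.1 h).1 x hx
  rw [← follows_raise_iff (m := E9 c b)] at this
  simpa [raise] using this

/-- Sequences of parts whose total degree falls short of `n` by exactly `d`. -/
def shiftedPartSeqs (d N : ℕ) (b : Fin 9) (n : ℕ) : Set (List (ℕ × Fin 9)) :=
  {l | ∃ m, m + d = n ∧ l ∈ partSeqs N b m}

lemma shiftedPartSeqs_of_le {d n : ℕ} (h : d ≤ n) (N : ℕ) (b : Fin 9) :
    shiftedPartSeqs d N b n = partSeqs N b (n - d) := by
  obtain ⟨m, rfl⟩ := Nat.exists_eq_add_of_le' h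
  ext l
  simp [shiftedPartSeqs]

lemma shiftedPartSeqs_of_lt {d n : ℕ} (h : n < d) (N : ℕ) (b : Fin 9) :
    shiftedPartSeqs d N b n = ∅ := by
  ext l
  simp only [shiftedPartSeqs, Set.mem_ofPred_eq, Set.mem_empty_iff_false, iff_false, not_exists,
    not_and]
  omega

lemma finite_shiftedPartSeqs (d N : ℕ) (b : Fin 9) (n : ℕ) :
    (shiftedPartSeqs d N b n).Finite := by
  rcases le_or_gt d n with h | h
  · rw [shiftedPartSeqs_of_le h]
    exact finite_partSeqs _ _ _
  · rw [shiftedPartSeqs_of_lt h]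
    exact Set.finite_empty

lemma sum_levelDeg_prependPart {b c : Fin 9} {l : List (ℕ × Fin 9)}
    (h : ((0, c) :: l).Pairwise Follows) :
    ((prependPart b c l).map levelDeg).sum =
      (l.map levelDeg).sum + levelDeg ((l.length + 1) * E9 c b, c) := by
  have h1 : Follows (0, b) (E9 c b, c) := by simp [Follows]
  have h2 := levelDeg_raise h1 (l.length * E9 c b)
  have e : (l.length + 1) * E9 c b = E9 c b + l.length * E9 c b := by ring
  simp only [raise] at h2
  rw [prependPart, List.map_cons, List.sum_cons, sum_levelDeg_raise (List.pairwise_cons.1 h).1,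
    e, h2]
  ring

lemma prependPart_mem_iff {N n : ℕ} {b c : Fin 9} {l : List (ℕ × Fin 9)} :
    prependPart b c l ∈ partSeqs (N + 1) b n ↔
      l ∈ shiftedPartSeqs (levelDeg ((N + 1) * E9 c b, c)) N c n := by
  have hl : (prependPart b c l).length = l.length + 1 := by simp [prependPart]
  simp only [partSeqs, shiftedPartSeqs, Set.mem_ofPred_eq, pairwise_prependPart_iff, hl,
    Nat.add_right_cancel_iff]
  constructor
  · rintro ⟨rfl, h2, h3⟩
    rw [sum_levelDeg_prependPart h2] at h3
    exact ⟨_, h3, rfl, h2, rfl⟩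
  · rintro ⟨_, h3, rfl, h2, rfl⟩
    rw [sum_levelDeg_prependPart h2]
    exact ⟨rfl, h2, h3⟩

lemma map_raise_mem {N n : ℕ} {b : Fin 9} {l : List (ℕ × Fin 9)}
    (h : l ∈ shiftedPartSeqs (3 * N) N b n) : l.map (raise 1) ∈ partSeqs N b n := by
  obtain ⟨m, rfl, rfl, h2, rfl⟩ := h
  rw [List.pairwise_cons] at h2
  refine ⟨by simp, ?_, ?_⟩
  · rw [List.pairwise_cons, List.pairwise_map, List.forall_mem_map]
    refine ⟨fun x hx => ?_, by simpa only [follows_raise_iff] using h2.2⟩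
    have := h2.1 x hx
    simp only [Follows, raise] at *
    omega
  · rw [sum_levelDeg_raise h2.1]
    ring

lemma mem_partSeqs_succ {N n : ℕ} {b : Fin 9} {l : List (ℕ × Fin 9)}
    (h : l ∈ partSeqs (N + 1) b n) :
    (∃ c, ∃ l' ∈ shiftedPartSeqs (levelDeg ((N + 1) * E9 c b, c)) N c n, prependPart b c l' = l) ∨
      ∃ l' ∈ shiftedPartSeqs (3 * (N + 1)) (N + 1) b n, l'.map (raise 1) = l := by
  obtain ⟨h1, h2, h3⟩ := id h
  obtain ⟨⟨k, c⟩, t, rfl⟩ := List.exists_cons_of_length_eq_add_one h1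
  rw [List.pairwise_cons, List.forall_mem_cons] at h2
  obtain ⟨⟨hk, -⟩, h2⟩ := h2
  have ht := (List.pairwise_cons.1 h2).1
  simp only [Follows, zero_add] at hk
  rcases hk.eq_or_lt with rfl | hk
  · left
    obtain ⟨t', rfl⟩ := exists_map_raise (m := E9 c b) (l := t) fun x hx => by
      have := ht x hx
      simp only [Follows] at this
      omega
    exact ⟨c, t', prependPart_mem_iff.1 h, rfl⟩
  · right
    obtain ⟨t', ht'⟩ := exists_map_raise (m := 1) (l := (k, c) :: t) fun x hx => by
      rcases List.mem_cons.1 hx with rfl | hx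
      · exact Nat.one_le_of_lt hk
      · have := ht x hx
        simp only [Follows] at this
        omega
    have hlen : t'.length = N + 1 := by rw [← h1, ← ht', List.length_map]
    obtain ⟨⟨k', c'⟩, u, rfl⟩ := List.exists_cons_of_length_eq_add_one hlen
    rw [← ht', List.pairwise_map] at h2
    simp only [follows_raise_iff] at h2
    have hhead : k' + 1 = k ∧ c' = c := by
      simpa [raise] using (List.cons.inj ht').1
    obtain ⟨rfl, rfl⟩ := hhead
    have h0 : Follows (0, b) (k', c') := by
      simp only [Follows, zero_add]
      omega
    have hall : ∀ x ∈ (k', c') :: u, Follows (0, b) x := by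
      rw [List.forall_mem_cons]
      exact ⟨h0, fun x hx => h0.trans ((List.pairwise_cons.1 h2).1 x hx)⟩
    refine ⟨_, ⟨_, ?_, hlen, List.pairwise_cons.2 ⟨hall, h2⟩, rfl⟩, ht'⟩
    rw [← h3, ← ht', sum_levelDeg_raise hall, hlen]
    ring

lemma ncard_partSeqs_succ (N : ℕ) (b : Fin 9) (n : ℕ) :
    (partSeqs (N + 1) b n).ncard =
      ∑ c, (shiftedPartSeqs (levelDeg ((N + 1) * E9 c b, c)) N c n).ncard
        + (shiftedPartSeqs (3 * (N + 1)) (N + 1) b n).ncard := by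
  let f : (Σ c, shiftedPartSeqs (levelDeg ((N + 1) * E9 c b, c)) N c n) ⊕
      shiftedPartSeqs (3 * (N + 1)) (N + 1) b n → partSeqs (N + 1) b n :=
    Sum.elim (fun p => ⟨prependPart b p.1 p.2, prependPart_mem_iff.2 p.2.2⟩)
      (fun l => ⟨l.1.map (raise 1), map_raise_mem l.2⟩)
  have hne : ∀ c l l', l' ∈ shiftedPartSeqs (3 * (N + 1)) (N + 1) b n →
      prependPart b c l ≠ l'.map (raise 1) := by
    rintro c l (_ | ⟨⟨k, c'⟩, t⟩) ⟨m, -, -, h, -⟩ he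
    · simp [prependPart] at he
    · have h' := (List.pairwise_cons.1 h).1 (k, c') (by simp)
      simp only [prependPart, List.map_cons, List.cons.injEq, raise, Prod.mk.injEq] at he
      obtain ⟨⟨h1, rfl⟩, -⟩ := he
      simp only [Follows] at h'
      omega
  have hf : Function.Bijective f := by
    refine ⟨Function.Injective.sumElim ?_ ?_ ?_, ?_⟩
    · rintro ⟨c, l, hl⟩ ⟨c', l', hl'⟩ h
      simp only [Subtype.mk.injEq, prependPart, List.cons.injEq, Prod.mk.injEq] at h
      obtain ⟨⟨-, rfl⟩, h⟩ := h
      obtain rfl := List.map_injective_iff.2 (raise_injective _) h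
      rfl
    · rintro ⟨l, hl⟩ ⟨l', hl'⟩ h
      simp only [Subtype.mk.injEq] at h
      exact Subtype.ext (List.map_injective_iff.2 (raise_injective _) h)
    · rintro ⟨c, l, hl⟩ ⟨l', hl'⟩ h
      exact hne c l l' hl' (congrArg Subtype.val h)
    · rintro ⟨l, hl⟩
      rcases mem_partSeqs_succ hl with ⟨c, l', hl', h⟩ | ⟨l', hl', h⟩
      · exact ⟨Sum.inl ⟨c, l', hl'⟩, Subtype.ext h⟩
      · exact ⟨Sum.inr ⟨l', hl'⟩, Subtype.ext h⟩
  have hfin : ∀ d N b, Finite (shiftedPartSeqs d N b n) := fun d N b =>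
    (finite_shiftedPartSeqs d N b n).to_subtype
  simp only [← Nat.card_coe_set_eq]
  rw [← Nat.card_congr (Equiv.ofBijective f hf), Nat.card_sum, Nat.card_sigma]

section Series

open PowerSeries

/-- The generating function of `partSeqs N b`. -/
noncomputable def partSeries (N : ℕ) (b : Fin 9) : ℚ⟦X⟧ :=
  PowerSeries.mk fun n => ((partSeqs N b n).ncard : ℚ)

lemma coeff_X_pow_mul_partSeries (d N : ℕ) (b : Fin 9) (n : ℕ) :
    coeff n (X ^ d * partSeries N b) = ((shiftedPartSeqs d N b n).ncard : ℚ) := by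
  rw [coeff_X_pow_mul']
  split_ifs with h
  · rw [shiftedPartSeqs_of_le h, partSeries, coeff_mk]
  · rw [shiftedPartSeqs_of_lt (not_le.1 h), Set.ncard_empty, Nat.cast_zero]

lemma partSeries_succ (N : ℕ) (b : Fin 9) :
    (1 - X ^ (3 * N + 3)) * partSeries (N + 1) b =
      ∑ c, X ^ levelDeg ((N + 1) * E9 c b, c) * partSeries N c := by
  ext n
  rw [sub_mul, one_mul, map_sub, map_sum, sub_eq_iff_eq_add]
  simp only [coeff_X_pow_mul_partSeries]
  rw [partSeries, coeff_mk, ncard_partSeqs_succ]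
  push_cast
  rfl

lemma partSeries_eq (N : ℕ) : partSeries N = crystalSeries N := by
  induction N with
  | zero =>
    have h0 : ∀ b, partSeries 0 b = 1 := by
      intro b
      ext n
      rw [partSeries, coeff_mk, coeff_one]
      have : partSeqs 0 b n = if n = 0 then {[]} else ∅ := by
        ext l
        split_ifs with hn <;> simp only [partSeqs, Set.mem_ofPred_eq, List.length_eq_zero_iff,
          Set.mem_singleton_iff, Set.mem_empty_iff_false] <;> constructor <;> aesop
      rw [this]
      split_ifs <;> simp
    funext b
    rw [h0]
    fin_cases b <;> simp [crystalSeries, durfeeSum, durfeeSum']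
  | succ N ih =>
    funext b
    have h0 : (1 : ℚ⟦X⟧) - X ^ (3 * N + 3) ≠ 0 := fun h => by
      simpa using congrArg constantCoeff h
    refine mul_left_cancel₀ h0 ?_
    rw [partSeries_succ, crystalSeries_succ, ih]

lemma ncard_partSeqs_self (n : ℕ) :
    (partSeqs n 3 n).ncard = Fintype.card (Nat.Partition n) := by
  have h := coeff_durfeeSum (k := 3) (by norm_num) n
  have h' : partSeries n 3 = durfeeSum 3 n := congrFun (partSeries_eq n) 3
  rw [← h', partSeries, coeff_mk] at h
  exact_mod_cast h

end Series

/-- A part of positive level, forgetting positivity. -/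
def toLevelPart (x : ℕ+ × Fin 9) : ℕ × Fin 9 := (x.1, x.2)

/-- A part regarded as a part of positive level, if it is one. -/
def toPosPart (x : ℕ × Fin 9) : Option (ℕ+ × Fin 9) :=
  if h : 0 < x.1 then some (⟨x.1, h⟩, x.2) else none

@[simp] lemma toPosPart_toLevelPart (x : ℕ+ × Fin 9) : toPosPart (toLevelPart x) = some x :=
  dif_pos x.1.pos

lemma eq_of_follows_zero {x : ℕ × Fin 9} (h : Follows (0, 3) x) :
    x = (0, 3) ∨ ∃ y, toPosPart x = some y ∧ toLevelPart y = x := by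
  have key : ∀ c, E9 c 3 = 0 → c = 3 := by decide
  simp only [Follows, zero_add] at h
  rcases Nat.eq_zero_or_pos x.1 with h0 | h0
  · exact Or.inl (Prod.ext h0 (key _ (by omega)))
  · exact Or.inr ⟨(⟨x.1, h0⟩, x.2), by simp [toPosPart, h0], rfl⟩

lemma exists_perm_replicate_append {l : List (ℕ × Fin 9)} (h : ∀ x ∈ l, Follows (0, 3) x) :
    l.Perm (List.replicate (l.length - (l.filterMap toPosPart).length) (0, 3) ++
      (l.filterMap toPosPart).map toLevelPart) := by
  suffices ∃ k, l.Perm (List.replicate k (0, 3) ++ (l.filterMap toPosPart).map toLevelPart) by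
    obtain ⟨k, hk⟩ := this
    have := hk.length_eq
    rw [List.length_append, List.length_replicate, List.length_map] at this
    rwa [this, Nat.add_sub_cancel]
  induction l with
  | nil => exact ⟨0, by simp⟩
  | cons x l ih =>
    rw [List.forall_mem_cons] at h
    obtain ⟨k, hk⟩ := ih h.2
    rcases eq_of_follows_zero h.1 with rfl | ⟨y, hy, hx⟩
    · refine ⟨k + 1, ?_⟩
      rw [List.filterMap_cons_none (by simp [toPosPart]), List.replicate_succ]
      exact hk.cons _
    · refine ⟨k, ?_⟩
      rw [List.filterMap_cons_some hy, List.map_cons, hx]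
      exact (hk.cons x).trans List.perm_middle.symm

lemma pair_le_coe_iff {α : Type*} {x y : α} {l : List α} :
    ({x, y} : Multiset α) ≤ l ↔ [x, y].Sublist l ∨ [y, x].Sublist l := by
  have e : ({x, y} : Multiset α) = ([x, y] : List α) := rfl
  rw [e, Multiset.coe_le]
  constructor
  · rintro ⟨t, ht, hl⟩
    rcases List.perm_pair.1 ht with rfl | rfl
    · exact Or.inl hl
    · exact Or.inr hl
  · rintro (h | h)
    · exact h.subperm
    · exact (List.Perm.swap y x []).subperm.trans h.subperm

lemma admissible_iff {π : Multiset (ℕ+ × Fin 9)} :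
    Admissible E9 π ↔ ∀ x y, {x, y} ≤ π →
      Follows (toLevelPart x) (toLevelPart y) ∨ Follows (toLevelPart y) (toLevelPart x) := by
  have hE : ∀ a b, E9 a b ≤ 2 := by decide
  constructor
  · rintro ⟨h1, h2⟩ ⟨i, a⟩ ⟨j, b⟩ h
    have hab := hE a b
    have hba := hE b a
    simp only [Follows, toLevelPart]
    rcases lt_trichotomy (i : ℕ) j with hij | hij | hij
    · rcases (Nat.succ_le_of_lt hij).eq_or_lt with hij' | hij'
      · obtain rfl : j = i + 1 := PNat.eq (by rw [← hij']; rfl)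
        have := h2 i b a (by rwa [Multiset.pair_comm])
        simp only [PNat.add_coe, PNat.one_coe]
        omega
      · omega
    · obtain rfl := PNat.eq hij
      have := Nat.mul_eq_zero.1 (h1 i a b h)
      omega
    · rcases (Nat.succ_le_of_lt hij).eq_or_lt with hij' | hij'
      · obtain rfl : i = j + 1 := PNat.eq (by rw [← hij']; rfl)
        have := h2 j a b h
        simp only [PNat.add_coe, PNat.one_coe]
        omega
      · omega
  · intro h
    refine ⟨fun j a b hab => ?_, fun j a b hab => ?_⟩
    · have := h _ _ hab
      simp only [Follows, toLevelPart] at this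
      rw [Nat.mul_eq_zero]
      omega
    · have := h _ _ hab
      simp only [Follows, toLevelPart, PNat.add_coe, PNat.one_coe] at this
      omega

lemma exists_pairwise_follows {π : Multiset (ℕ+ × Fin 9)} (h : Admissible E9 π) :
    ∃ l : List (ℕ+ × Fin 9), (l : Multiset (ℕ+ × Fin 9)) = π ∧
      (l.map toLevelPart).Pairwise Follows := by
  have hE : ∀ a b, E9 a b = 0 → b ≤ a := by decide
  let key : ℕ+ × Fin 9 → ℕ := fun x => 9 * x.1 + x.2
  let R : ℕ+ × Fin 9 → ℕ+ × Fin 9 → Prop := fun x y => key x ≤ key y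
  have : Std.Total R := ⟨fun x y => le_total (key x) (key y)⟩
  have : IsTrans _ R := ⟨fun x y z => le_trans⟩
  induction π using Quotient.inductionOn with | _ l
  refine ⟨l.insertionSort R, Multiset.coe_eq_coe.2 (List.perm_insertionSort R l), ?_⟩
  rw [List.pairwise_map, List.pairwise_iff_forall_sublist]
  intro x y hxy
  have hR : R x y := List.pairwise_iff_forall_sublist.1 (List.pairwise_insertionSort R l) hxy
  have hle : ({x, y} : Multiset _) ≤ (l : Multiset _) := by
    rw [← Multiset.coe_eq_coe.2 (List.perm_insertionSort R l)]
    exact pair_le_coe_iff.2 (Or.inl hxy)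
  refine (admissible_iff.1 h x y hle).elim id fun hyx => ?_
  have hf := hyx
  simp only [Follows, toLevelPart, R, key] at hf hR
  have e1 : (x.1 : ℕ) = y.1 := by omega
  have e2 := hE x.2 y.2 (by omega)
  have e3 : x.2 = y.2 := le_antisymm (by rw [Fin.le_def]; omega) e2
  obtain rfl : x = y := Prod.ext (PNat.eq e1) e3
  exact hyx

lemma toLevelPart_of_toPosPart {x : ℕ × Fin 9} {y : ℕ+ × Fin 9} (h : toPosPart x = some y) :
    toLevelPart y = x := by
  simp only [toPosPart, Option.dite_none_right_eq_some, Option.some.injEq] at h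
  obtain ⟨h0, rfl⟩ := h
  rfl

lemma admissible_filterMap {l : List (ℕ × Fin 9)} (h : l.Pairwise Follows) :
    Admissible E9 (l.filterMap toPosPart : Multiset (ℕ+ × Fin 9)) := by
  have h' : (l.filterMap toPosPart).Pairwise
      fun x y => Follows (toLevelPart x) (toLevelPart y) := by
    rw [List.pairwise_filterMap]
    refine h.imp fun {a b} hab x hx y hy => ?_
    rwa [toLevelPart_of_toPosPart hx, toLevelPart_of_toPosPart hy]
  rw [admissible_iff]
  intro x y hxy
  rw [List.pairwise_iff_forall_sublist] at h'
  exact (pair_le_coe_iff.1 hxy).imp (fun h => h' h) (fun h => h' h)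

lemma sum_deg9_filterMap {l : List (ℕ × Fin 9)} (h : ∀ x ∈ l, Follows (0, 3) x) :
    ((l.filterMap toPosPart).map deg9).sum = (l.map levelDeg).sum := by
  rw [((exists_perm_replicate_append h).map levelDeg).sum_eq]
  simp only [List.map_append, List.map_replicate, List.sum_append, List.map_map]
  have : levelDeg ∘ toLevelPart = deg9 := rfl
  rw [this]
  simp [levelDeg]

theorem crystal_RR_identity (n : ℕ) :
    Nat.card {π : Multiset (ℕ+ × Fin 9) //
        Admissible E9 π ∧ (π.map deg9).sum = n}
      = Fintype.card (Nat.Partition n) := by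
  rw [← ncard_partSeqs_self, ← Nat.card_coe_set_eq]
  symm
  refine Nat.card_congr (Equiv.ofBijective
    (fun l => ⟨(l.1.filterMap toPosPart : List _), ?_, ?_⟩) ⟨?_, ?_⟩)
  · exact admissible_filterMap (List.pairwise_cons.1 l.2.2.1).2
  · rw [Multiset.map_coe, Multiset.sum_coe, sum_deg9_filterMap (List.pairwise_cons.1 l.2.2.1).1]
    exact l.2.2.2
  · rintro ⟨l, hl, hp, hs⟩ ⟨l', hl', hp', hs'⟩ h
    simp only [Subtype.mk.injEq, Multiset.coe_eq_coe] at h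
    rw [List.pairwise_cons] at hp hp'
    have h1 := exists_perm_replicate_append hp.1
    have h2 := exists_perm_replicate_append hp'.1
    rw [hl, h.length_eq] at h1
    rw [hl'] at h2
    refine Subtype.ext (List.Perm.eq_of_pairwise (fun a b _ _ => Follows.antisymm) hp.2 hp'.2 ?_)
    exact h1.trans (((h.map _).append_left _).trans h2.symm)
  · rintro ⟨π, hπ, hn⟩
    obtain ⟨L, rfl, hL⟩ := exists_pairwise_follows hπ
    have hlen : L.length ≤ n := by
      rw [← hn, Multiset.map_coe, Multiset.sum_coe, ← L.length_map (f := deg9)]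
      refine List.length_le_sum_of_one_le _ fun i hi => ?_
      obtain ⟨x, -, rfl⟩ := List.mem_map.1 hi
      exact (show 1 ≤ (toLevelPart x).1 from x.1.pos).trans (le_levelDeg (toLevelPart x))
    have hE : ∀ c, E9 c 3 ≤ 1 := by decide
    have hpos : ∀ x, Follows (0, 3) (toLevelPart x) := fun x => by
      have h1 := hE x.2
      have h2 := x.1.pos
      simp only [Follows, toLevelPart]
      omega
    have h00 : Follows (0, 3) (0, 3) := by simp [Follows, E9]
    have hall : ∀ x ∈ List.replicate (n - L.length) (0, 3) ++ L.map toLevelPart,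
        Follows (0, 3) x := by
      intro x hx
      rcases List.mem_append.1 hx with hx | hx
      · rwa [List.eq_of_mem_replicate hx]
      · obtain ⟨y, -, rfl⟩ := List.mem_map.1 hx
        exact hpos y
    have hfilter : (List.replicate (n - L.length) (0, 3) ++ L.map toLevelPart).filterMap toPosPart
        = L := by
      rw [List.filterMap_append, List.filterMap_replicate_of_none (by simp [toPosPart]),
        List.filterMap_map]
      simp
    refine ⟨⟨List.replicate (n - L.length) (0, 3) ++ L.map toLevelPart, ?_, ?_, ?_⟩, ?_⟩
    · simp [hlen]
    · refine List.pairwise_cons.2 ⟨hall, List.pairwise_append.2 ⟨?_, hL, ?_⟩⟩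
      · exact List.pairwise_replicate.2 (Or.inr h00)
      · intro a ha b hb
        rw [List.eq_of_mem_replicate ha]
        exact hall b (List.mem_append_right _ hb)
    · rw [← sum_deg9_filterMap hall, hfilter, ← hn, Multiset.map_coe, Multiset.sum_coe]
    · exact Subtype.ext (congrArg ((↑) : List (ℕ+ × Fin 9) → Multiset (ℕ+ × Fin 9)) hfilter)
end

section
/- Let Γ' = {1,2,3,5,6,7,8,9} with degrees |(-i)_1| = 3i-2, |(-i)_2| = |(-i)_3| = 3i-1, |(-i)_5| = |(-i)_6| = 3i, |(-i)_7| = |(-i)_8| = 3i+1, |(-i)_9| = 3i+2, and the 8×8 matrix E with rows (in order 1,2,3,5,6,7,8,9): (2,2,2,2,2,2,2,2), (1,2,1,2,1,2,2,2), (1,1,2,1,2,2,2,2), (0,1,1,1,1,1,2,2), (1,1,1,1,1,2,1,2), (0,1,0,1,1,2,1,2), (0,0,1,1,1,1,2,2), (0,0,0,0,1,1,1,2). A colored partition is admissible if it contains none of: a pair i_α i_β with E α β E β α ≥ 1; a pair (i-1)_α i_β with E α β = 2; a triple (i-1)_3, i_5, i_1; a triple (i-1)_9, (i-1)_5, i_7.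 Then ∑_{n≥0} a(n) q^n = ∏_{r ≥ 1, 3∤r} (1 - q^r)^{-1}, where a(n) counts admissible colored partitions of degree n. -/
/-- The difference condition matrix for the weighted `A_2`-crystal
`Γ' = {1,2,3,5,6,7,8,9}`, indexed in this order by `Fin 8`. -/
def E8 : Fin 8 → Fin 8 → ℕ :=
  ![![2,2,2,2,2,2,2,2],
    ![1,2,1,2,1,2,2,2],
    ![1,1,2,1,2,2,2,2],
    ![0,1,1,1,1,1,2,2],
    ![1,1,1,1,1,2,1,2],
    ![0,1,0,1,1,2,1,2],
    ![0,0,1,1,1,1,2,2],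
    ![0,0,0,0,1,1,1,2]]

/-- Degrees under the principal specialization (colors `1,2,3,5,6,7,8,9` are the
indices `0,…,7`): `|(-j)_1| = 3j-2`, `|(-j)_2| = |(-j)_3| = 3j-1`,
`|(-j)_5| = |(-j)_6| = 3j`, `|(-j)_7| = |(-j)_8| = 3j+1`, `|(-j)_9| = 3j+2`. -/
def deg8 (x : ℕ+ × Fin 8) : ℕ :=
  ![3 * (x.1 : ℕ) - 2, 3 * (x.1 : ℕ) - 1, 3 * (x.1 : ℕ) - 1,
    3 * (x.1 : ℕ), 3 * (x.1 : ℕ),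
    3 * (x.1 : ℕ) + 1, 3 * (x.1 : ℕ) + 1, 3 * (x.1 : ℕ) + 2] x.2

/-- The Meurman–Primc difference conditions for the basic `A_2^{(1)}`-module:
no pair `i_α i_β` with `E α β ⬝ E β α ≥ 1`, no pair `(i-1)_α i_β` with
`E α β = 2`, no triple `(i-1)_3 i_5 i_1` and no triple `(i-1)_9 (i-1)_5 i_7`.
(Here color `3` is index `2`, `5` is `3`, `1` is `0`, `9` is `7`, `7` is `5`.) -/
def Admissible8 (π : Multiset (ℕ+ × Fin 8)) : Prop :=
  (∀ (j : ℕ+) (α β : Fin 8),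
      ({(j, α), (j, β)} : Multiset (ℕ+ × Fin 8)) ≤ π → E8 α β * E8 β α = 0) ∧
  (∀ (j : ℕ+) (α β : Fin 8),
      ({(j + 1, α), (j, β)} : Multiset (ℕ+ × Fin 8)) ≤ π → E8 α β ≠ 2) ∧
  (∀ j : ℕ+,
      ¬ ({(j + 1, (2 : Fin 8)), (j, (3 : Fin 8)), (j, (0 : Fin 8))} :
          Multiset (ℕ+ × Fin 8)) ≤ π) ∧
  (∀ j : ℕ+,
      ¬ ({(j + 1, (7 : Fin 8)), (j + 1, (3 : Fin 8)), (j, (5 : Fin 8))} :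
          Multiset (ℕ+ × Fin 8)) ≤ π)

namespace MeurmanPrimc

open PowerSeries Finset

/-- The finite product `(q; q)_m`. -/
noncomputable def qPoch (m : ℕ) : ℚ⟦X⟧ := ∏ i ∈ range m, (1 - X ^ (i + 1))

/-- The finite product `(q³; q³)_m`. -/
noncomputable def cubePoch (m : ℕ) : ℚ⟦X⟧ := ∏ i ∈ range m, (1 - X ^ (3 * (i + 1)))

lemma qPoch_succ (m : ℕ) : qPoch (m + 1) = qPoch m * (1 - X ^ (m + 1)) :=
  prod_range_succ _ _

lemma cubePoch_succ (m : ℕ) : cubePoch (m + 1) = cubePoch m * (1 - X ^ (3 * (m + 1))) :=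
  prod_range_succ _ _

lemma constantCoeff_qPoch (m : ℕ) : constantCoeff (qPoch m) = 1 := by
  simp [qPoch, map_prod]

lemma constantCoeff_cubePoch (m : ℕ) : constantCoeff (cubePoch m) = 1 := by
  simp [cubePoch, map_prod]

lemma qPoch_mul_inv (m : ℕ) : qPoch m * (qPoch m)⁻¹ = 1 :=
  PowerSeries.mul_inv_cancel _ (by simp [constantCoeff_qPoch])

lemma cubePoch_mul_inv (m : ℕ) : cubePoch m * (cubePoch m)⁻¹ = 1 :=
  PowerSeries.mul_inv_cancel _ (by simp [constantCoeff_cubePoch])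

lemma qPoch_inv_succ (m : ℕ) : (qPoch m)⁻¹ = (qPoch (m + 1))⁻¹ * (1 - X ^ (m + 1)) := by
  have h := qPoch_mul_inv m
  have h' := qPoch_mul_inv (m + 1)
  rw [qPoch_succ] at h' ⊢
  linear_combination (qPoch m)⁻¹ * (-h') + (qPoch m * (1 - X ^ (m + 1)))⁻¹ * (1 - X ^ (m + 1)) * h

lemma cubePoch_inv_succ (m : ℕ) :
    (cubePoch m)⁻¹ = (cubePoch (m + 1))⁻¹ * (1 - X ^ (3 * (m + 1))) := by
  have h := cubePoch_mul_inv m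
  have h' := cubePoch_mul_inv (m + 1)
  rw [cubePoch_succ] at h' ⊢
  linear_combination (cubePoch m)⁻¹ * (-h') +
    (cubePoch m * (1 - X ^ (3 * (m + 1))))⁻¹ * (1 - X ^ (3 * (m + 1))) * h

/-- The summand of the explicit solution of the transfer recurrences. -/
noncomputable def term (a N m : ℕ) : ℚ⟦X⟧ :=
  X ^ (m ^ 2 + a * m) * cubePoch m * (qPoch m)⁻¹ ^ 2 * (cubePoch (N + m))⁻¹

/-- The truncated sum of `term a N`. -/
noncomputable def partialSum (K a N : ℕ) : ℚ⟦X⟧ := ∑ m ∈ range K, term a N m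

lemma X_pow_dvd_term (a N K : ℕ) : (X : ℚ⟦X⟧) ^ K ∣ term a N K := by
  unfold term
  rw [mul_assoc, mul_assoc]
  exact (pow_dvd_pow _ (by nlinarith [Nat.le_self_pow two_ne_zero K])).mul_right _

/-- Sums of `u m = D m - D (m + 1)` with `D 0 = 0` and `D K` small vanish modulo `X ^ K`. -/
lemma X_pow_dvd_sum_of_telescope {K : ℕ} {u D : ℕ → ℚ⟦X⟧} (h : ∀ m, u m = D m - D (m + 1))
    (h0 : D 0 = 0) (hK : X ^ K ∣ D K) : X ^ K ∣ ∑ m ∈ range K, u m := by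
  rw [sum_congr rfl fun m _ => h m, sum_range_sub', h0, zero_sub]
  exact hK.neg_right

lemma partialSum_three_term (K N : ℕ) :
    X ^ K ∣ partialSum K (3 * N) N - (partialSum K (3 * N + 1) (N + 1)
      + X ^ (3 * N + 1) * partialSum K (3 * N + 2) (N + 1)
      + X ^ (3 * N + 2) * partialSum K (3 * N + 3) (N + 1)) := by
  simp only [partialSum, mul_sum, ← sum_add_distrib, ← sum_sub_distrib]
  refine X_pow_dvd_sum_of_telescope (D := fun m => term (3 * N) N m * (1 - X ^ m)) (fun m => ?_)
    (by simp) ((X_pow_dvd_term _ _ _).mul_right _)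
  simp only [term, cubePoch_succ m, show N + 1 + m = N + m + 1 by ring,
    show N + (m + 1) = N + m + 1 by ring, qPoch_inv_succ m, cubePoch_inv_succ (N + m)]
  ring

lemma partialSum_down (K N : ℕ) :
    X ^ K ∣ partialSum K (3 * N + 2) (N + 1) - (2 * partialSum K (3 * N + 3) (N + 1)
      - (1 - X ^ (3 * N + 3)) * partialSum K (3 * N + 4) (N + 2)) := by
  simp only [partialSum, mul_sum, ← sum_sub_distrib]
  refine X_pow_dvd_sum_of_telescope (D := fun m => term (3 * N + 2) (N + 1) m * (1 - X ^ m) ^ 2)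
    (fun m => ?_) (by simp) ((X_pow_dvd_term _ _ _).mul_right _)
  simp only [term, cubePoch_succ m, show N + 1 + m = N + m + 1 by ring,
    show N + 1 + (m + 1) = N + m + 1 + 1 by ring, show N + 2 + m = N + m + 1 + 1 by ring,
    qPoch_inv_succ m, cubePoch_inv_succ (N + m + 1)]
  ring

lemma partialSum_second_difference (K N : ℕ) :
    X ^ K ∣ (partialSum K (3 * N + 1) (N + 1) - 2 * partialSum K (3 * N + 2) (N + 1)
        + partialSum K (3 * N + 3) (N + 1))
      - X ^ (3 * N + 2) * (partialSum K (3 * N + 3) (N + 1)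
        - X ^ 3 * (1 - X ^ (3 * N + 3)) * partialSum K (3 * N + 6) (N + 2)) := by
  simp only [partialSum, mul_sum, ← sum_add_distrib, ← sum_sub_distrib]
  refine X_pow_dvd_sum_of_telescope (D := fun m => term (3 * N + 1) (N + 1) m * (1 - X ^ m) ^ 2)
    (fun m => ?_) (by simp) ((X_pow_dvd_term _ _ _).mul_right _)
  simp only [term, cubePoch_succ m, show N + 1 + m = N + m + 1 by ring,
    show N + 1 + (m + 1) = N + m + 1 + 1 by ring, show N + 2 + m = N + m + 1 + 1 by ring,
    qPoch_inv_succ m, cubePoch_inv_succ (N + m + 1)]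
  ring

/-- The sets of colors that may occur at a single level of an admissible partition. -/
def state : Fin 19 → Finset (Fin 8) :=
  ![∅, {0}, {1}, {2}, {3}, {4}, {5}, {6}, {7}, {0, 3}, {0, 5}, {0, 6}, {0, 7}, {1, 6}, {1, 7},
    {2, 5}, {2, 7}, {3, 7}, {0, 3, 7}]

/-- The degree of a color relative to the smallest degree of its level. -/
def colorShift : Fin 8 → ℕ := ![0, 1, 1, 2, 2, 3, 3, 4]

/-- The total degree of the parts of color in `state t` at level `N + 1`. -/
def levelDegree (N : ℕ) (t : Fin 19) : ℕ := ∑ α ∈ state t, (3 * N + 1 + colorShift α)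

/-- The color set `S` at some level may be followed by the color set `T` at the next level. -/
def Compat (S T : Finset (Fin 8)) : Prop :=
  (∀ α ∈ T, ∀ β ∈ S, E8 α β ≠ 2) ∧ ¬(2 ∈ T ∧ 3 ∈ S ∧ 0 ∈ S) ∧ ¬(7 ∈ T ∧ 3 ∈ T ∧ 5 ∈ S)

instance (S T : Finset (Fin 8)) : Decidable (Compat S T) := by
  unfold Compat; infer_instance

/-- The states that may follow a given state. -/
def successors (s : Fin 19) : Finset (Fin 19) := {t | Compat (state s) (state t)}

lemma successors_eq : successors =
    ![univ, {0, 2, 3, 4, 5, 6, 7, 8, 13, 14, 15, 16, 17}, {0, 3, 4, 5, 6, 7, 8, 15, 16, 17},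
      {0, 2, 4, 5, 6, 7, 8, 13, 14, 17}, {0, 3, 4, 5, 6, 7, 8, 15, 16, 17},
      {0, 2, 4, 5, 6, 7, 8, 13, 14, 17}, {0, 4, 7, 8}, {0, 5, 6, 8}, {0},
      {0, 4, 5, 6, 7, 8, 17}, {0, 4, 7, 8}, {0, 5, 6, 8}, {0}, {0, 5, 6, 8}, {0},
      {0, 4, 7, 8}, {0}, {0}, {0}] := by
  decide +kernel

/-- The explicit solution (up to a constant and modulo `X ^ K`) of the transfer recurrences: the
generating function of the parts at levels beyond `N`, given the state at level `N`. -/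
noncomputable def solution (K N : ℕ) : Fin 19 → ℚ⟦X⟧ :=
  let f := partialSum K (3 * N) N
  let p := partialSum K (3 * N + 3) (N + 1)
  let r := partialSum K (3 * N + 2) (N + 1)
  let s := partialSum K (3 * N + 1) (N + 1)
  let y := X ^ (3 * N + 2) * p
  ![f, s + y, s, s, s, s, r, r, p, s - y, r, r, p, r, p, r, p, p, p]

lemma X_pow_levelDegree (N : ℕ) (t : Fin 19) : (X : ℚ⟦X⟧) ^ levelDegree N t =
    (X ^ (3 * N + 1)) ^ (state t).card * X ^ ∑ α ∈ state t, colorShift α := by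
  rw [levelDegree, sum_add_distrib, pow_add, sum_const, smul_eq_mul, mul_comm (state t).card,
    pow_mul]

lemma solution_recurrence (K N : ℕ) (s : Fin 19) :
    X ^ K ∣ solution K N s -
      ∑ t ∈ successors s, X ^ levelDegree N t * solution K (N + 1) t := by
  obtain ⟨e₀, h₀⟩ := partialSum_three_term K N
  obtain ⟨e₁, h₁⟩ := partialSum_three_term K (N + 1)
  obtain ⟨e₂, h₂⟩ := partialSum_down K N
  obtain ⟨e₃, h₃⟩ := partialSum_second_difference K N
  have hc : (fun t => (state t).card) =
      ![0, 1, 1, 1, 1, 1, 1, 1, 1, 2, 2, 2, 2, 2, 2, 2, 2, 2, 3] := by decide +kernel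
  have hd : (fun t => ∑ α ∈ state t, colorShift α) =
      ![0, 0, 1, 1, 2, 2, 3, 3, 4, 2, 3, 3, 4, 4, 5, 4, 5, 6, 6] := by decide +kernel
  have hw (t : Fin 19) : (X : ℚ⟦X⟧) ^ levelDegree N t =
    (X ^ (3 * N + 1)) ^ ((![0, 1, 1, 1, 1, 1, 1, 1, 1, 2, 2, 2, 2, 2, 2, 2, 2, 2, 3] : Fin 19 → ℕ) t)
     * X ^ ((![0, 0, 1, 1, 2, 2, 3, 3, 4, 2, 3, 3, 4, 4, 5, 4, 5, 6, 6] : Fin 19 → ℕ) t) := by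
    rw [X_pow_levelDegree, ← hc, ← hd]
  rw [successors_eq]
  simp only [hw, solution]
  simp only [show 3 * (N + 1) = 3 * N + 3 by ring, show 3 * N + 3 + 1 = 3 * N + 4 by ring,
    show 3 * N + 3 + 2 = 3 * N + 5 by ring, show 3 * N + 3 + 3 = 3 * N + 6 by ring] at *
  rw [show N + 1 + 1 = N + 2 from rfl] at *
  generalize partialSum K (3 * N) N = f at *
  generalize partialSum K (3 * N + 3) (N + 1) = p at *
  generalize partialSum K (3 * N + 2) (N + 1) = r at *
  generalize partialSum K (3 * N + 1) (N + 1) = u at *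
  generalize partialSum K (3 * N + 6) (N + 2) = p' at *
  generalize partialSum K (3 * N + 5) (N + 2) = r' at *
  generalize partialSum K (3 * N + 4) (N + 2) = u' at *
  fin_cases s <;> simp [Fin.sum_univ_succ] <;> first
    | done
    | exact ⟨e₂ + e₁, by linear_combination h₂ + h₁⟩
    | exact ⟨e₃ + 2 * e₂ + (2 + X ^ (3 * N + 2)) * e₁,
        by linear_combination h₃ + 2 * h₂ + (2 + X ^ (3 * N + 2)) * h₁⟩
    | exact ⟨e₃ + 2 * e₂ + 2 * e₁, by linear_combination h₃ + 2 * h₂ + 2 * h₁⟩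
    | exact ⟨e₃ + 2 * e₂ + (2 + 2 * X ^ (3 * N + 2)) * e₁,
        by linear_combination h₃ + 2 * h₂ + (2 + 2 * X ^ (3 * N + 2)) * h₁⟩
    | exact ⟨e₀ + e₃ + (2 + X ^ (3 * N + 1)) * e₂
          + (2 + 2 * X ^ (3 * N + 1) + 2 * X ^ (3 * N + 2)) * e₁,
        by linear_combination h₀ + h₃ + (2 + X ^ (3 * N + 1)) * h₂
          + (2 + 2 * X ^ (3 * N + 1) + 2 * X ^ (3 * N + 2)) * h₁⟩

/-- The generating function of the color assignments to the levels `N + 1, …, N + L` that are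
compatible with the state `s` at level `N`. -/
noncomputable def transfer : ℕ → ℕ → Fin 19 → ℚ⟦X⟧
  | 0, _, _ => 1
  | L + 1, N, s => ∑ t ∈ successors s, X ^ levelDegree N t * transfer L (N + 1) t

lemma X_pow_dvd_cubePoch_sub {K N : ℕ} (h : K ≤ N) : X ^ K ∣ cubePoch N - cubePoch K := by
  induction N, h using Nat.le_induction with
  | base => simp
  | succ N hN ih =>
    obtain ⟨d, rfl⟩ := Nat.exists_eq_add_of_le hN
    obtain ⟨e, he⟩ := ih
    exact ⟨e - X ^ (2 * K + 3 * d + 3) * cubePoch (K + d), by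
      rw [cubePoch_succ]; linear_combination he⟩

lemma X_pow_dvd_cubePoch_mul_partialSum {K a N : ℕ} (ha : K ≤ a) (hN : K ≤ N) :
    X ^ K ∣ cubePoch K * partialSum K a N - 1 := by
  obtain _ | k := K
  · simp
  have h : X ^ (k + 1) ∣ ∑ m ∈ range k, term a N (m + 1) := dvd_sum fun m _ => by
    unfold term
    rw [mul_assoc, mul_assoc]
    exact (pow_dvd_pow _ (by nlinarith [Nat.zero_le (a * m)])).mul_right _
  obtain ⟨e, he⟩ := h
  obtain ⟨e', he'⟩ := X_pow_dvd_cubePoch_sub hN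
  have h0 : term a N 0 = (cubePoch N)⁻¹ := by simp [term, qPoch, cubePoch]
  refine ⟨cubePoch (k + 1) * e - (cubePoch N)⁻¹ * e', ?_⟩
  rw [partialSum, sum_range_succ', h0]
  linear_combination cubePoch (k + 1) * he - (cubePoch N)⁻¹ * he' + cubePoch_mul_inv N

lemma X_pow_dvd_solution_sub_transfer {K L N : ℕ} (h : N + L = K) (s : Fin 19) :
    X ^ K ∣ cubePoch K * solution K N s - transfer L N s := by
  induction L generalizing N s with
  | zero =>
    obtain rfl : N = K := h
    obtain ⟨e₀, h₀⟩ := X_pow_dvd_cubePoch_mul_partialSum (K := N) (a := 3 * N) (N := N)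
      (by omega) le_rfl
    obtain ⟨e₁, h₁⟩ := X_pow_dvd_cubePoch_mul_partialSum (K := N) (a := 3 * N + 1) (N := N + 1)
      (by omega) (by omega)
    obtain ⟨e₂, h₂⟩ := X_pow_dvd_cubePoch_mul_partialSum (K := N) (a := 3 * N + 2) (N := N + 1)
      (by omega) (by omega)
    obtain ⟨e₃, h₃⟩ := X_pow_dvd_cubePoch_mul_partialSum (K := N) (a := 3 * N + 3) (N := N + 1)
      (by omega) (by omega)
    rw [solution]
    generalize partialSum N (3 * N) N = f at *
    generalize partialSum N (3 * N + 1) (N + 1) = u at *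
    generalize partialSum N (3 * N + 2) (N + 1) = r at *
    generalize partialSum N (3 * N + 3) (N + 1) = p at *
    fin_cases s <;> simp [transfer] <;> first
      | exact ⟨e₀, h₀⟩
      | exact ⟨e₁, h₁⟩
      | exact ⟨e₂, h₂⟩
      | exact ⟨e₃, h₃⟩
      | exact ⟨e₁ + X ^ (2 * N + 2) * cubePoch N * p, by linear_combination h₁⟩
      | exact ⟨e₁ - X ^ (2 * N + 2) * cubePoch N * p, by linear_combination h₁⟩
  | succ L ih =>
    have h₁ := (solution_recurrence K N s).mul_left (cubePoch K)
    have h₂ : X ^ K ∣ ∑ t ∈ successors s, X ^ levelDegree N t *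
        (cubePoch K * solution K (N + 1) t - transfer L (N + 1) t) :=
      dvd_sum fun t _ => (ih (by omega) t).mul_left _
    convert h₁.add h₂ using 1
    simp only [transfer, mul_sub, mul_sum, sum_sub_distrib, mul_left_comm (cubePoch K)]
    ring

/-- The truncated sum `∑ q^(m² + N m) / ((q)_m (q)_{m + N})` over Durfee rectangles. -/
noncomputable def durfeeSum (K N : ℕ) : ℚ⟦X⟧ :=
  ∑ m ∈ range K, X ^ (m ^ 2 + N * m) * (qPoch m)⁻¹ * (qPoch (m + N))⁻¹

lemma X_pow_dvd_durfeeSum_sub_succ (K N : ℕ) :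
    X ^ K ∣ durfeeSum K N - durfeeSum K (N + 1) := by
  simp only [durfeeSum, ← sum_sub_distrib]
  refine X_pow_dvd_sum_of_telescope
    (D := fun m => X ^ (m ^ 2 + N * m) * (qPoch m)⁻¹ * (qPoch (m + N))⁻¹ * (1 - X ^ m))
    (fun m => ?_) (by simp) ?_
  · simp only [show m + (N + 1) = m + N + 1 by ring, show m + 1 + N = m + N + 1 by ring,
      qPoch_inv_succ m, qPoch_inv_succ (m + N)]
    ring
  · simp only [mul_assoc]
    exact (pow_dvd_pow _ (by nlinarith [Nat.le_self_pow two_ne_zero K])).mul_right _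

lemma X_pow_dvd_durfeeSum_zero_sub (K N : ℕ) : X ^ K ∣ durfeeSum K 0 - durfeeSum K N := by
  induction N with
  | zero => simp
  | succ N ih => simpa using ih.add (X_pow_dvd_durfeeSum_sub_succ K N)

lemma X_pow_dvd_durfeeSum_mul_qPoch {K N : ℕ} (h : K ≤ N) :
    X ^ K ∣ durfeeSum K N * qPoch N - 1 := by
  obtain _ | k := K
  · simp
  have h : X ^ (k + 1) ∣ ∑ m ∈ range k,
      X ^ ((m + 1) ^ 2 + N * (m + 1)) * (qPoch (m + 1))⁻¹ * (qPoch (m + 1 + N))⁻¹ :=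
    dvd_sum fun m _ => by
      rw [mul_assoc]
      exact (pow_dvd_pow _ (by nlinarith [Nat.zero_le (N * m)])).mul_right _
  obtain ⟨e, he⟩ := h
  have h0 : (qPoch 0)⁻¹ = 1 := by simp [qPoch]
  refine ⟨qPoch N * e, ?_⟩
  rw [durfeeSum, sum_range_succ', zero_add N, h0]
  linear_combination qPoch N * he + qPoch_mul_inv N

/-- The product of `1 - q^r` over the `r < 3 K` not divisible by three. -/
noncomputable def nonmultiplePoch (K : ℕ) : ℚ⟦X⟧ :=
  ∏ r ∈ range K, (1 - X ^ (3 * r + 1)) * (1 - X ^ (3 * r + 2))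

lemma qPoch_three_mul (K : ℕ) : qPoch (3 * K) = cubePoch K * nonmultiplePoch K := by
  induction K with
  | zero => simp [qPoch, cubePoch, nonmultiplePoch]
  | succ K ih =>
    rw [nonmultiplePoch, prod_range_succ, ← nonmultiplePoch, cubePoch_succ,
      show 3 * (K + 1) = 3 * K + 1 + 1 + 1 by ring, qPoch_succ, qPoch_succ, qPoch_succ, ih]
    ring

lemma X_pow_dvd_transfer_mul_nonmultiplePoch (K : ℕ) :
    X ^ K ∣ transfer K 0 0 * nonmultiplePoch K - 1 := by
  have h : solution K 0 0 = durfeeSum K 0 := by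
    refine sum_congr (rfl : range K = _) fun m _ => ?_
    simp only [term, mul_zero, zero_mul, zero_add, add_zero]
    linear_combination X ^ m ^ 2 * (qPoch m)⁻¹ ^ 2 * cubePoch_mul_inv m
  obtain ⟨e₁, h₁⟩ := X_pow_dvd_solution_sub_transfer (zero_add K) 0
  obtain ⟨e₂, h₂⟩ := X_pow_dvd_durfeeSum_zero_sub K (3 * K)
  obtain ⟨e₃, h₃⟩ := X_pow_dvd_durfeeSum_mul_qPoch (K := K) (N := 3 * K) (by omega)
  refine ⟨e₂ * qPoch (3 * K) + e₃ - nonmultiplePoch K * e₁, ?_⟩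
  rw [h] at h₁
  linear_combination h₂ * qPoch (3 * K) + h₃ - nonmultiplePoch K * h₁
    - durfeeSum K 0 * qPoch_three_mul K

/-- The sequence of states starting with `s`, followed by `σ`, and then constantly empty. -/
def profile {L : ℕ} (s : Fin 19) (σ : Fin L → Fin 19) : ℕ → Fin 19
  | 0 => s
  | i + 1 => if h : i < L then σ ⟨i, h⟩ else 0

lemma profile_cons {L : ℕ} (s t : Fin 19) (σ : Fin L → Fin 19) (i : ℕ) :
    profile s (Fin.cons t σ : Fin (L + 1) → Fin 19) (i + 1) = profile t σ i := by
  cases i with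
  | zero => simp [profile]
  | succ i =>
    by_cases h : i < L
    · simp only [profile, h, Nat.add_lt_add_iff_right, dif_pos]
      exact Fin.cons_succ (α := fun _ => Fin 19) t σ ⟨i, h⟩
    · simp [profile, h]

/-- Consecutive states of the profile are compatible. -/
def Valid {L : ℕ} (s : Fin 19) (σ : Fin L → Fin 19) : Prop :=
  ∀ i, profile s σ (i + 1) ∈ successors (profile s σ i)

lemma zero_mem_successors (s : Fin 19) : 0 ∈ successors s := by
  revert s; decide +kernel

lemma successors_zero : successors 0 = univ := by
  decide +kernel

lemma valid_cons {L : ℕ} (s t : Fin 19) (σ : Fin L → Fin 19) :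
    Valid s (Fin.cons t σ : Fin (L + 1) → Fin 19) ↔ t ∈ successors s ∧ Valid t σ := by
  unfold Valid
  rw [← Nat.and_forall_add_one]
  simp only [profile_cons]
  rfl

open Classical in
lemma transfer_eq_sum (L N : ℕ) (s : Fin 19) :
    transfer L N s = ∑ σ : Fin L → Fin 19,
      if Valid s σ then X ^ ∑ i : Fin L, levelDegree (N + i) (σ i) else 0 := by
  induction L generalizing N s with
  | zero =>
    have (σ : Fin 0 → Fin 19) : Valid s σ := fun i => zero_mem_successors _
    simp [transfer, this]
  | succ L ih =>
    rw [← (Fin.consEquiv fun _ => Fin 19).sum_comp, Fintype.sum_prod_type, transfer,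
      ← sum_subset (subset_univ (successors s))]
    · refine sum_congr rfl fun t ht => ?_
      rw [ih, mul_sum]
      refine sum_congr rfl fun σ _ => ?_
      simp [Fin.consEquiv, valid_cons, ht, Fin.sum_univ_succ, pow_add, add_assoc, add_comm 1]
    · intro t _ ht
      simp [Fin.consEquiv, valid_cons, ht]

lemma coeff_transfer (K n : ℕ) :
    coeff n (transfer K 0 0) = Nat.card {σ : Fin K → Fin 19 //
      Valid 0 σ ∧ ∑ i : Fin K, levelDegree i (σ i) = n} := by
  classical
  rw [transfer_eq_sum, map_sum, Nat.card_eq_fintype_card, Fintype.card_subtype, card_filter,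
    Nat.cast_sum]
  refine sum_congr rfl fun σ _ => ?_
  by_cases h : Valid 0 σ <;> simp [h, coeff_X_pow, eq_comm]

/-- The parts described by the states `σ 0, σ 1, …` at levels `1, 2, …`. -/
def toMultiset {K : ℕ} (σ : Fin K → Fin 19) : Multiset (ℕ+ × Fin 8) :=
  (univ.sigma fun i => state (σ i)).val.map fun x => (Nat.succPNat x.1, x.2)

lemma nodup_toMultiset {K : ℕ} (σ : Fin K → Fin 19) : (toMultiset σ).Nodup := by
  refine Multiset.Nodup.map ?_ (Finset.nodup _)
  rintro ⟨i, α⟩ ⟨j, β⟩ h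
  simp only [Prod.mk.injEq, Nat.succPNat_inj, Fin.val_inj] at h
  obtain ⟨rfl, rfl⟩ := h
  rfl

lemma mem_toMultiset {K : ℕ} (σ : Fin K → Fin 19) (j : ℕ+) (α : Fin 8) :
    (j, α) ∈ toMultiset σ ↔ α ∈ state (profile 0 σ j) := by
  obtain ⟨i, rfl⟩ : ∃ i, j = Nat.succPNat i := ⟨j.natPred, by simp⟩
  rw [Nat.succPNat_coe, Nat.succ_eq_add_one, profile]
  simp only [toMultiset, Multiset.mem_map, mem_val, mem_sigma, mem_univ, true_and, Sigma.exists,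
    Prod.mk.injEq, Nat.succPNat_inj]
  split_ifs with h
  · exact ⟨by rintro ⟨k, _, hk, rfl, rfl⟩; exact hk, fun h' => ⟨⟨i, h⟩, α, h', rfl, rfl⟩⟩
  · refine ⟨by rintro ⟨k, _, hk, rfl, rfl⟩; exact absurd k.2 h, fun h' => ?_⟩
    exact absurd h' (Finset.notMem_empty α)

lemma sum_deg8_toMultiset {K : ℕ} (σ : Fin K → Fin 19) :
    ((toMultiset σ).map deg8).sum = ∑ i : Fin K, levelDegree i (σ i) := by
  rw [toMultiset, Multiset.map_map]
  change ∑ x ∈ univ.sigma fun i => state (σ i), deg8 (Nat.succPNat x.1, x.2) = _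
  rw [sum_sigma]
  refine sum_congr rfl fun i _ => sum_congr rfl fun α _ => ?_
  fin_cases α <;> simp [deg8, colorShift] <;> omega

/-- No two colors of `S` are forbidden to occur at the same level. -/
def Coexist (S : Finset (Fin 8)) : Prop :=
  ∀ α ∈ S, ∀ β ∈ S, α ≠ β → E8 α β * E8 β α = 0

instance (S : Finset (Fin 8)) : Decidable (Coexist S) := by
  unfold Coexist; infer_instance

lemma coexist_state (t : Fin 19) : Coexist (state t) := by
  revert t; decide +kernel

lemma exists_state_eq {S : Finset (Fin 8)} (h : Coexist S) : ∃ t, state t = S := by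
  revert S; decide +kernel

lemma state_injective : Function.Injective state := by
  unfold Function.Injective; decide +kernel

lemma nodup_of_admissible8 {π : Multiset (ℕ+ × Fin 8)} (h : Admissible8 π) : π.Nodup := by
  rw [Multiset.nodup_iff_le]
  rintro ⟨j, α⟩ hle
  have h' := h.1 j α α hle
  revert h'
  exact (by decide : ∀ α, ¬ E8 α α * E8 α α = 0) α

lemma admissible8_iff {π : Multiset (ℕ+ × Fin 8)} (hπ : π.Nodup) {g : ℕ+ → Finset (Fin 8)}
    (hg : ∀ j α, (j, α) ∈ π ↔ α ∈ g j) :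
    Admissible8 π ↔ ∀ j, Coexist (g j) ∧ Compat (g j) (g (j + 1)) := by
  have hne (j : ℕ+) : j + 1 ≠ j := (PNat.lt_add_right j 1).ne'
  have hpair (x y : ℕ+ × Fin 8) (hxy : x ≠ y) : ({x, y} : Multiset _) ≤ π ↔ x ∈ π ∧ y ∈ π := by
    rw [Multiset.le_iff_subset (by simpa using hxy)]
    simp [Multiset.subset_iff]
  have htriple (x y z : ℕ+ × Fin 8) (hxy : x ≠ y) (hxz : x ≠ z) (hyz : y ≠ z) :
      ({x, y, z} : Multiset _) ≤ π ↔ x ∈ π ∧ y ∈ π ∧ z ∈ π := by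
    rw [Multiset.le_iff_subset (by simp [hxy, hxz, hyz])]
    simp [Multiset.subset_iff]
  have h₁ : (∀ (j : ℕ+) (α β : Fin 8), ({(j, α), (j, β)} : Multiset (ℕ+ × Fin 8)) ≤ π →
      E8 α β * E8 β α = 0) ↔ ∀ j, Coexist (g j) := by
    refine forall_congr' fun j => ⟨fun h α hα β hβ hne => h α β ?_, fun h α β hle => ?_⟩
    · rw [hpair _ _ (by simpa using hne), hg, hg]
      exact ⟨hα, hβ⟩
    · have hne : (j, α) ≠ (j, β) := by simpa using Multiset.nodup_of_le hle hπ
      rw [hpair _ _ hne, hg, hg] at hle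
      exact h α hle.1 β hle.2 (by simpa using hne)
  rw [Admissible8, h₁, forall_and]
  simp only [Compat, forall_and]
  refine and_congr_right' (and_congr ?_ (and_congr ?_ ?_))
  · refine forall_congr' fun j => ?_
    simp only [hpair (j + 1, _) (j, _) (by simp [hne]), hg]
    tauto
  · refine forall_congr' fun j => ?_
    rw [htriple _ _ _ (by simp [hne]) (by simp [hne]) (by simp), hg, hg, hg]
  · refine forall_congr' fun j => ?_
    rw [htriple _ _ _ (by simp) (by simp [hne]) (by simp [hne]), hg, hg, hg]

lemma admissible8_toMultiset_iff {K : ℕ} (σ : Fin K → Fin 19) :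
    Admissible8 (toMultiset σ) ↔ Valid 0 σ := by
  rw [admissible8_iff (nodup_toMultiset σ) (mem_toMultiset σ), Valid, ← Nat.and_forall_add_one]
  simp only [coexist_state, true_and, PNat.add_coe, PNat.one_coe]
  have h0 : profile 0 σ (0 + 1) ∈ successors (profile 0 σ 0) := by
    simp [profile, successors_zero]
  simp only [h0, true_and]
  refine ⟨fun h i => ?_, fun h j => ?_⟩
  · simpa [successors] using h (Nat.succPNat i)
  · obtain ⟨i, rfl⟩ : ∃ i, j = Nat.succPNat i := ⟨j.natPred, by simp⟩
    simpa [successors] using h i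

lemma le_deg8 (j : ℕ+) (α : Fin 8) : (j : ℕ) ≤ deg8 (j, α) := by
  have := j.pos
  fin_cases α <;> simp [deg8] <;> omega

lemma exists_toMultiset_eq {K : ℕ} {π : Multiset (ℕ+ × Fin 8)} (h : Admissible8 π)
    (hK : (π.map deg8).sum ≤ K) : ∃ σ : Fin K → Fin 19, toMultiset σ = π := by
  classical
  let g (j : ℕ+) : Finset (Fin 8) := {α | (j, α) ∈ π}
  have hg (j : ℕ+) (α : Fin 8) : (j, α) ∈ π ↔ α ∈ g j := by simp [g]
  have hco := (admissible8_iff (nodup_of_admissible8 h) hg).1 h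
  choose t ht using fun j => exists_state_eq (hco j).1
  refine ⟨fun i => t (Nat.succPNat i), ?_⟩
  rw [Multiset.Nodup.ext (nodup_toMultiset _) (nodup_of_admissible8 h)]
  rintro ⟨j, α⟩
  rw [mem_toMultiset, hg]
  obtain ⟨i, rfl⟩ : ∃ i, j = Nat.succPNat i := ⟨j.natPred, by simp⟩
  rw [Nat.succPNat_coe, Nat.succ_eq_add_one, profile]
  split_ifs with hi
  · rw [ht]
  · refine iff_of_false (Finset.notMem_empty α) fun hα => hi ?_
    have h₁ := Multiset.le_sum_of_mem (Multiset.mem_map_of_mem deg8 ((hg _ _).2 hα))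
    have h₂ := le_deg8 (Nat.succPNat i) α
    rw [Nat.succPNat_coe] at h₂
    omega

lemma toMultiset_injective (K : ℕ) :
    Function.Injective (toMultiset : (Fin K → Fin 19) → Multiset (ℕ+ × Fin 8)) := by
  intro σ τ h
  funext i
  apply state_injective
  ext α
  have h' := mem_toMultiset σ (Nat.succPNat i) α
  rw [h, mem_toMultiset] at h'
  simpa [profile] using h'.symm

lemma card_admissible8 {K n : ℕ} (h : n ≤ K) :
    Nat.card {σ : Fin K → Fin 19 // Valid 0 σ ∧ ∑ i : Fin K, levelDegree i (σ i) = n} =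
      Nat.card {π : Multiset (ℕ+ × Fin 8) // Admissible8 π ∧ (π.map deg8).sum = n} := by
  refine Nat.card_congr (Equiv.ofBijective (fun σ => ⟨toMultiset σ.1,
    (admissible8_toMultiset_iff _).2 σ.2.1, by rw [sum_deg8_toMultiset, σ.2.2]⟩) ⟨?_, ?_⟩)
  · intro σ τ hστ
    exact Subtype.ext (toMultiset_injective K (congrArg Subtype.val hστ))
  · rintro ⟨π, hπ, rfl⟩
    obtain ⟨σ, rfl⟩ := exists_toMultiset_eq hπ h
    exact ⟨⟨σ, (admissible8_toMultiset_iff σ).1 hπ, (sum_deg8_toMultiset σ).symm⟩, rfl⟩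

lemma nonmultiplePoch_eq (K : ℕ) :
    nonmultiplePoch K = ∏ i ∈ range (3 * K), if 3 ∣ i + 1 then 1 else 1 - X ^ (i + 1) := by
  induction K with
  | zero => rfl
  | succ K ih =>
    rw [nonmultiplePoch, prod_range_succ, ← nonmultiplePoch, ih,
      show 3 * (K + 1) = 3 * K + 1 + 1 + 1 by ring, prod_range_succ, prod_range_succ,
      prod_range_succ, if_neg (by omega), if_neg (by omega), if_pos (by omega)]
    ring

open PowerSeries.WithPiTopology in
lemma mk_card_restricted_mul_nonmultiplePoch (K : ℕ) :
    PowerSeries.mk (fun n => (#(Nat.Partition.restricted n fun i => ¬ 3 ∣ i ∧ i ≤ 3 * K) : ℚ))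
      * nonmultiplePoch K = 1 := by
  have h := Nat.Partition.hasProd_powerSeriesMk_card_restricted ℚ
    (fun i => ¬ 3 ∣ i ∧ i ≤ 3 * K)
  rw [h.unique (hasProd_prod_of_ne_finset_one (s := range (3 * K)) fun i hi => if_neg fun hp =>
    hi (mem_range.2 hp.2)), nonmultiplePoch_eq, ← prod_mul_distrib]
  refine prod_eq_one fun i hi => ?_
  have hi' : i + 1 ≤ 3 * K := mem_range.1 hi
  by_cases h3 : 3 ∣ i + 1
  · simp [h3]
  · simp only [h3, hi', not_false_eq_true, and_self, if_true, if_false, pow_mul]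
    exact tsum_pow_mul_one_sub_of_constantCoeff_eq_zero (by simp)

lemma card_restricted_eq {K n : ℕ} (h : n ≤ 3 * K) :
    #(Nat.Partition.restricted n fun i => ¬ 3 ∣ i ∧ i ≤ 3 * K) =
      Nat.card {μ : Multiset ℕ+ //
        (∀ m ∈ μ, ¬ (3 ∣ (m : ℕ))) ∧ (μ.map (fun i => (i : ℕ))).sum = n} := by
  have hmap (μ : Multiset ℕ+) :
      (μ >>= fun i => pure (i : ℕ) : Multiset ℕ).map (fun i => i) = μ.map PNat.val := by
    simp [Multiset.bind_def, Multiset.pure_def, Multiset.bind_singleton]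
  simp only [hmap]
  rw [← Nat.card_eq_finsetCard]
  symm
  refine Nat.card_congr (Equiv.ofBijective (fun μ => ⟨⟨μ.1.map PNat.val, ?_, μ.2.2⟩, ?_⟩)
    ⟨?_, ?_⟩)
  · intro i hi
    obtain ⟨j, -, rfl⟩ := Multiset.mem_map.1 hi
    exact j.pos
  · obtain ⟨μ, hμ, rfl⟩ := μ
    simp only [Nat.Partition.restricted, mem_filter, mem_univ, true_and]
    intro i hi
    refine ⟨?_, (Multiset.le_sum_of_mem hi).trans h⟩
    obtain ⟨j, hj, rfl⟩ := Multiset.mem_map.1 hi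
    exact hμ j hj
  · intro μ ν hμν
    refine Subtype.ext (Multiset.map_injective PNat.coe_injective ?_)
    exact congrArg (fun x => x.1.parts) hμν
  · rintro ⟨x, hx⟩
    obtain ⟨μ, hμ⟩ := (Multiset.canLift PNat.val (0 < ·)).prf x.parts
      fun i hi => x.parts_pos hi
    refine ⟨⟨μ, fun m hm => ?_, by rw [hμ, x.parts_sum]⟩, Subtype.ext (Nat.Partition.ext hμ)⟩
    simp only [Nat.Partition.restricted, mem_filter, mem_univ, true_and] at hx
    exact (hx m (hμ ▸ Multiset.mem_map_of_mem _ hm)).1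

lemma coeff_transfer_eq_card_restricted (n : ℕ) :
    coeff n (transfer (n + 1) 0 0) =
      #(Nat.Partition.restricted n fun i => ¬ 3 ∣ i ∧ i ≤ 3 * (n + 1)) := by
  have h := mk_card_restricted_mul_nonmultiplePoch (n + 1)
  set P := PowerSeries.mk fun m =>
    (#(Nat.Partition.restricted m fun i => ¬ 3 ∣ i ∧ i ≤ 3 * (n + 1)) : ℚ) with hP
  have h' : X ^ (n + 1) ∣ transfer (n + 1) 0 0 - P := by
    obtain ⟨e, he⟩ := X_pow_dvd_transfer_mul_nonmultiplePoch (n + 1)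
    exact ⟨e * P, by linear_combination P * he - transfer (n + 1) 0 0 * h⟩
  have := X_pow_dvd_iff.1 h' n n.lt_succ_self
  rw [map_sub, sub_eq_zero] at this
  rw [this, hP, coeff_mk]

end MeurmanPrimc

/-- The Meurman–Primc identity for the basic `A_2^{(1)}`-module: admissible
colored partitions of `n` are counted by partitions of `n` into parts not
divisible by `3`, i.e. `∑ a(n) qⁿ = ∏_{3∤r} (1 - q^r)⁻¹`. -/
theorem meurman_primc_identity (n : ℕ) :
    Nat.card {π : Multiset (ℕ+ × Fin 8) //
        Admissible8 π ∧ (π.map deg8).sum = n}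
      = Nat.card {μ : Multiset ℕ+ //
          (∀ m ∈ μ, ¬ (3 ∣ (m : ℕ))) ∧ (μ.map (fun i => (i : ℕ))).sum = n} := by
  rw [← MeurmanPrimc.card_admissible8 n.le_succ,
    ← MeurmanPrimc.card_restricted_eq (K := n + 1) (by omega), ← Nat.cast_inj (R := ℚ),
    ← MeurmanPrimc.coeff_transfer, MeurmanPrimc.coeff_transfer_eq_card_restricted]
end
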